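/- Let S_a and S_b be deterministic metric systems with the same output set Y and metric d, and let ε ≥ 0. Then S_a is ε-approximately bisimilar to S_b (S_a ≅_S^ε S_b) if and only if S_a is alternatingly ε-approximately bisimilar to S_b (S_a ≅_AS^ε S_b). -/

import Mathlib

open scoped ENNReal

/-- A system `S = (X, X₀, U, ⟶, Y, H)`: a set of initial states, a transition
relation and an output map.  The (possibly infinite) sets of states, inputs and
outputs are given as the types `X`, `U`, `Y`. -/
structure Sys (X U Y : Type*) where
  init : Set X
  tr : X → U → X → Prop
  out : X → Y

namespace Sys

variable {X U Y : Type*}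

/-- `Post_u(x)`: the set of `u`-successors of `x`. -/
def Post (S : Sys X U Y) (u : U) (x : X) : Set X := {x' | S.tr x u x'}

/-- `U(x)`: the set of inputs enabled at `x`, i.e. with at least one successor. -/
def enabled (S : Sys X U Y) (x : X) : Set U := {u | (S.Post u x).Nonempty}

/-- Every input is enabled at every state (`U(x) = U` for all `x`). -/
def AllEnabled (S : Sys X U Y) : Prop := ∀ (x : X) (u : U), (S.Post u x).Nonempty

/-- Deterministic: every state has at most one `u`-successor for every input `u`. -/
def Deterministic (S : Sys X U Y) : Prop := ∀ (x : X) (u : U), (S.Post u x).Subsingleton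

end Sys

/-- `d` is a metric on `Y`. -/
def IsMetric {Y : Type*} (d : Y → Y → ℝ) : Prop :=
  (∀ y y', 0 ≤ d y y') ∧
  (∀ y y', d y y' = d y' y) ∧
  (∀ y y' y'', d y y'' ≤ d y y' + d y' y'') ∧
  (∀ y y', d y y' = 0 ↔ y = y')

/-- `R` is an `ε`-approximate simulation relation from `Sa` to `Sb`, the outputs
being compared with the (possibly extended) metric `d`. -/
def ApproxSim {Xa Ua Xb Ub Y : Type*} (d : Y → Y → ℝ≥0∞) (ε : ℝ≥0∞)
    (Sa : Sys Xa Ua Y) (Sb : Sys Xb Ub Y) (R : Set (Xa × Xb)) : Prop :=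
  (∀ xa0 ∈ Sa.init, ∃ xb0 ∈ Sb.init, (xa0, xb0) ∈ R) ∧
  (∀ xa xb, (xa, xb) ∈ R → d (Sa.out xa) (Sb.out xb) ≤ ε) ∧
  (∀ xa xb, (xa, xb) ∈ R → ∀ ua xa', Sa.tr xa ua xa' →
      ∃ ub xb', Sb.tr xb ub xb' ∧ (xa', xb') ∈ R)

/-- `R` is an alternating `ε`-approximate simulation relation from `Sa` to `Sb`. -/
def AltApproxSim {Xa Ua Xb Ub Y : Type*} (d : Y → Y → ℝ≥0∞) (ε : ℝ≥0∞)
    (Sa : Sys Xa Ua Y) (Sb : Sys Xb Ub Y) (R : Set (Xa × Xb)) : Prop :=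
  (∀ xa0 ∈ Sa.init, ∃ xb0 ∈ Sb.init, (xa0, xb0) ∈ R) ∧
  (∀ xa xb, (xa, xb) ∈ R → d (Sa.out xa) (Sb.out xb) ≤ ε) ∧
  (∀ xa xb, (xa, xb) ∈ R → ∀ ua ∈ Sa.enabled xa, ∃ ub ∈ Sb.enabled xb,
      ∀ xb' ∈ Sb.Post ub xb, ∃ xa' ∈ Sa.Post ua xa, (xa', xb') ∈ R)

/-- `Sa ⪯_S^ε Sb`. -/
def Sim {Xa Ua Xb Ub Y : Type*} (d : Y → Y → ℝ≥0∞) (ε : ℝ≥0∞)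
    (Sa : Sys Xa Ua Y) (Sb : Sys Xb Ub Y) : Prop :=
  ∃ R : Set (Xa × Xb), ApproxSim d ε Sa Sb R

/-- `Sa ⪯_AS^ε Sb`. -/
def AltSim {Xa Ua Xb Ub Y : Type*} (d : Y → Y → ℝ≥0∞) (ε : ℝ≥0∞)
    (Sa : Sys Xa Ua Y) (Sb : Sys Xb Ub Y) : Prop :=
  ∃ R : Set (Xa × Xb), AltApproxSim d ε Sa Sb R

/-- `Sa ≅_S^ε Sb`: some `R` is an `ε`-approximate simulation relation from `Sa`
to `Sb` and its inverse `R⁻¹` is one from `Sb` to `Sa`. -/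
def Bisim {Xa Ua Xb Ub Y : Type*} (d : Y → Y → ℝ≥0∞) (ε : ℝ≥0∞)
    (Sa : Sys Xa Ua Y) (Sb : Sys Xb Ub Y) : Prop :=
  ∃ R : Set (Xa × Xb), ApproxSim d ε Sa Sb R ∧
    ApproxSim d ε Sb Sa {p : Xb × Xa | (p.2, p.1) ∈ R}

/-- `Sa ≅_AS^ε Sb`. -/
def AltBisim {Xa Ua Xb Ub Y : Type*} (d : Y → Y → ℝ≥0∞) (ε : ℝ≥0∞)
    (Sa : Sys Xa Ua Y) (Sb : Sys Xb Ub Y) : Prop :=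
  ∃ R : Set (Xa × Xb), AltApproxSim d ε Sa Sb R ∧
    AltApproxSim d ε Sb Sa {p : Xb × Xa | (p.2, p.1) ∈ R}

/-- `ĝ(j, N_{Nmin}, …, N_{Nmax})`:  the minimum of the quantities
`max {0, N_k - k}` for `k ∈ [Nmin; Nmax - j]` (each term
`max {0, N_{Nmax-i-j} + j + i - Nmax}` of the paper equals the truncated
subtraction `N_k - k` with `k = Nmax - i - j`) and of `1`;  hence it is `0`
iff some `k ∈ [Nmin; Nmax - j]` satisfies `N_k ≤ k`, and `1` otherwise. -/
noncomputable def ghat (Nmin Nmax : ℕ) (Nd : ℕ → ℕ) (j : ℕ) : ℕ :=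
  haveI := Classical.propDecidable
  if ∃ k, Nmin ≤ k ∧ k ≤ Nmax - j ∧ Nd k ≤ k then 0 else 1

/-- `f̂(N_{Nmin}, …, N_{Nmax}) = max argmin_{j ∈ [0; Nmax - Nmin]} ĝ(j, ⋯)`. -/
noncomputable def fhat (Nmin Nmax : ℕ) (Nd : ℕ → ℕ) : ℕ :=
  sSup {j | j ≤ Nmax - Nmin ∧
    ∀ j' ≤ Nmax - Nmin, ghat Nmin Nmax Nd j ≤ ghat Nmin Nmax Nd j'}

/-- Entry `k` (1-indexed) of a buffer `(b₁, …, bₙ)`, with a default value used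
for out-of-range indices. -/
def buf {α : Type*} {n : ℕ} (b : Fin n → α) (dflt : α) (k : ℕ) : α :=
  if h : k - 1 < n then b ⟨k - 1, h⟩ else dflt

/-- Push a new value at the front of a buffer, dropping the oldest entry:
`push a (b₁, …, bₙ) = (a, b₁, …, bₙ₋₁)`. -/
def push {α : Type*} {n : ℕ} (a : α) (b : Fin n → α) : Fin n → α := fun i =>
  if 0 < (i : ℕ) then b ⟨(i : ℕ) - 1, Nat.lt_of_le_of_lt (Nat.sub_le _ _) i.isLt⟩
  else a

/-- The stored delays of a delay buffer, as a (1-indexed) `ℕ`-valued function. -/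
def delays {a b n : ℕ} (Nb : Fin n → Set.Icc a b) (k : ℕ) : ℕ :=
  if h : k - 1 < n then (Nb ⟨k - 1, h⟩ : ℕ) else 0

/-- The state set of the networked version `𝒩(S)`:  a buffer of `N^sc_max`
measurements (where `none` plays the role of the dummy symbol `q`), a buffer of
`N^ca_max` control inputs, and the corresponding buffers of delays, which take
values in `[N^sc_min; N^sc_max]` and `[N^ca_min; N^ca_max]` respectively. -/
abbrev NState (Xτ U : Type*) (Nsmin Nsmax Ncmin Ncmax : ℕ) :=
  (Fin Nsmax → Option Xτ) × (Fin Ncmax → U) ×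
    (Fin Nsmax → Set.Icc Nsmin Nsmax) × (Fin Ncmax → Set.Icc Ncmin Ncmax)

/-- The networked version `𝒩(S)` of a system `S`, for delay bounds
`N^sc_min ≤ N^sc_max` and `N^ca_min ≤ N^ca_max`.  Outputs are pairs over
`Y_τ ∪ {q}`, encoded as `Option Yτ` with `none` playing the role of `q`. -/
noncomputable def networked {Xτ U Yτ : Type*} (S : Sys Xτ U Yτ)
    (Nsmin Nsmax Ncmin Ncmax : ℕ) (hsc : Nsmin ≤ Nsmax) (hca : Ncmin ≤ Ncmax) :
    Sys (NState Xτ U Nsmin Nsmax Ncmin Ncmax) U (Option Yτ × Option Yτ) where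
  init := {s | ∃ x0 ∈ S.init, ∃ u0 : U,
    s.1 = (fun i : Fin Nsmax => if (i : ℕ) = 0 then some x0 else none) ∧
    s.2.1 = (fun _ => u0) ∧
    s.2.2.1 = (fun _ => ⟨Nsmax, Set.mem_Icc.mpr ⟨hsc, le_rfl⟩⟩) ∧
    s.2.2.2 = (fun _ => ⟨Ncmax, Set.mem_Icc.mpr ⟨hca, le_rfl⟩⟩)}
  tr := fun s u s' =>
    ∃ (Nsc : Set.Icc Nsmin Nsmax) (Nca : Set.Icc Ncmin Ncmax) (x1 x' : Xτ),
      buf s.1 none 1 = some x1 ∧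
      S.tr x1 (buf s.2.1 u (Ncmax - fhat Ncmin Ncmax (delays s.2.2.2))) x' ∧
      s' = (push (some x') s.1, push u s.2.1, push Nsc s.2.2.1, push Nca s.2.2.2)
  out := fun s =>
    (Option.map S.out (buf s.1 none 1),
      Option.map S.out (buf s.1 none (Nsmax - fhat Nsmin Nsmax (delays s.2.2.1))))

/-- The state set of the static networked version `𝒩̄(S)`. -/
abbrev NStateS (Xτ U : Type*) (Nmin Nmax : ℕ) :=
  Xτ × (Fin Nmax → U) × (Fin Nmax → Set.Icc Nmin Nmax)

/-- The static networked version `𝒩̄(S)` of a system `S`, for delay bounds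
`N_min ≤ N_max`. -/
def staticNetworked {Xτ U Yτ : Type*} (S : Sys Xτ U Yτ)
    (Nmin Nmax : ℕ) (h : Nmin ≤ Nmax) :
    Sys (NStateS Xτ U Nmin Nmax) U Yτ where
  init := {s | ∃ x0 ∈ S.init, ∃ u0 : U,
    s.1 = x0 ∧ s.2.1 = (fun _ => u0) ∧
    s.2.2 = (fun _ => ⟨Nmax, Set.mem_Icc.mpr ⟨h, le_rfl⟩⟩)}
  tr := fun s u s' =>
    ∃ (N : Set.Icc Nmin Nmax) (x' : Xτ),
      S.tr s.1 (buf s.2.1 u (Nmax - fhat Nmin Nmax (delays s.2.2))) x' ∧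
      s' = (x', push u s.2.1, push N s.2.2)
  out := fun s => S.out s.1

/-- The lift of a real-valued metric on `Yτ` to an `ℝ≥0∞`-valued one. -/
noncomputable def dE {Yτ : Type*} (d : Yτ → Yτ → ℝ) (y y' : Yτ) : ℝ≥0∞ := ENNReal.ofReal (d y y')

/-- The extension of the metric `d` on `Yτ` to `Yτ ∪ {q}` (encoded as
`Option Yτ`, `none` playing the role of the dummy symbol `q`):  the distance
from `q` to any `y ≠ q` is `+∞`, and `d(q, q) = 0`. -/
noncomputable def dOpt {Yτ : Type*} (d : Yτ → Yτ → ℝ) : Option Yτ → Option Yτ → ℝ≥0∞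
  | some y, some y' => ENNReal.ofReal (d y y')
  | none, none => 0
  | _, _ => ⊤

/-- The output metric `d_Y` of the networked construction:  the maximum of the
componentwise extended distances. -/
noncomputable def dPair {Yτ : Type*} (d : Yτ → Yτ → ℝ)
    (p p' : Option Yτ × Option Yτ) : ℝ≥0∞ :=
  max (dOpt d p.1 p'.1) (dOpt d p.2 p'.2)

/-- Between deterministic systems, approximate and alternating approximate simulation relations
coincide. -/
theorem approxSim_iff_altApproxSim {Xa Ua Xb Ub Y : Type*} (d : Y → Y → ℝ≥0∞) (ε : ℝ≥0∞)
    {Sa : Sys Xa Ua Y} {Sb : Sys Xb Ub Y} (ha : Sa.Deterministic) (hb : Sb.Deterministic)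
    (R : Set (Xa × Xb)) : ApproxSim d ε Sa Sb R ↔ AltApproxSim d ε Sa Sb R := by
  refine and_congr_right fun _ => and_congr_right fun _ => ?_
  constructor
  · rintro h xa xb hR ua ⟨xa', hxa'⟩
    obtain ⟨ub, xb', hxb', hR'⟩ := h xa xb hR ua xa' hxa'
    refine ⟨ub, ⟨xb', hxb'⟩, fun y hy => ⟨xa', hxa', ?_⟩⟩
    rwa [hb xb ub hy hxb']
  · intro h xa xb hR ua xa' hxa'
    obtain ⟨ub, ⟨xb', hxb'⟩, hub⟩ := h xa xb hR ua ⟨xa', hxa'⟩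
    obtain ⟨x, hx, hR'⟩ := hub xb' hxb'
    refine ⟨ub, xb', hxb', ?_⟩
    rwa [ha xa ua hxa' hx]

/-- For deterministic metric systems, `S_a ≅_S^ε S_b` iff
`S_a ≅_AS^ε S_b`. -/
theorem bisim_iff_altBisim_of_deterministic
    {Xa Ua Xb Ub Y : Type*}
    (d : Y → Y → ℝ) (hd : IsMetric d)
    (Sa : Sys Xa Ua Y) (Sb : Sys Xb Ub Y)
    (ha : Sa.Deterministic) (hb : Sb.Deterministic)
    (ε : ℝ) (hε : 0 ≤ ε) :
    Bisim (dE d) (ENNReal.ofReal ε) Sa Sb ↔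
      AltBisim (dE d) (ENNReal.ofReal ε) Sa Sb := by
  exact exists_congr fun R => and_congr (approxSim_iff_altApproxSim _ _ ha hb R)
    (approxSim_iff_altApproxSim _ _ hb ha _)
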